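/- arXiv:2512.05077 — 6 statements merged into one kernel-verified Lean document; each statement's English description precedes it below -/
import Mathlib

section
/- Let n ≥ 2 be an integer, let ε, K ∈ ℝ, and define f(y,τ) = ε·(y² − 2) − K·e^{−τ}·(y⁴ − 12y² + 12). Let (y,τ) be a point at which 8(n−1) + 4·f(y,τ) + (∂_y f(y,τ))² > 0 and ∂_y² f(y,τ) + 2 ≥ 0. Then at this point ∂_τ f ≥ ∂_y² f − (y/2)·∂_y f + f − ((∂_y² f + 2)·(∂_y f)²)/(8(n−1) + 4f + (∂_y f)²); that is, 𝒬⁺_{ε,K} := εH₂ − Ke^{−τ}H₄ is a pointwise supersolution of the evolution equation satisfied by q = u² − 2(n−1) under rescaled mean curvature flow. -/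
theorem hasDerivAt_hermite_combination (a b x : ℝ) :
    HasDerivAt (fun x => a * (x ^ 2 - 2) - b * (x ^ 4 - 12 * x ^ 2 + 12))
      (a * (2 * x) - b * (4 * x ^ 3 - 24 * x)) x := by
  have h2 := hasDerivAt_pow 2 x
  have h4 := hasDerivAt_pow 4 x
  refine (((h2.sub_const 2).const_mul a).sub
    (((h4.sub (h2.const_mul 12)).add_const 12).const_mul b)).congr_deriv ?_
  push_cast
  ring

theorem hasDerivAt_deriv_hermite_combination (a b x : ℝ) :
    HasDerivAt (fun x => a * (2 * x) - b * (4 * x ^ 3 - 24 * x))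
      (2 * a - b * (12 * x ^ 2 - 24)) x := by
  have h1 := hasDerivAt_id' x
  have h3 := hasDerivAt_pow 3 x
  refine (((h1.const_mul 2).const_mul a).sub
    (((h3.const_mul 4).sub (h1.const_mul 24)).const_mul b)).congr_deriv ?_
  push_cast
  ring


/-- `𝒬⁺_{ε,K} := ε·H₂ − K·e^{−τ}·H₄` is a pointwise supersolution of the
evolution equation satisfied by `q = u² − 2(n−1)` under rescaled mean curvature flow,
at any point where `8(n−1) + 4f + (∂_y f)² > 0` and `∂_y² f + 2 ≥ 0`. -/
theorem stmt_1 (n : ℕ) (hn : 2 ≤ n) (ε K : ℝ) (f : ℝ → ℝ → ℝ)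
    (hf : ∀ y τ : ℝ,
      f y τ = ε * (y ^ 2 - 2) - K * Real.exp (-τ) * (y ^ 4 - 12 * y ^ 2 + 12))
    (y τ : ℝ)
    (hpos : 0 < 8 * ((n : ℝ) - 1) + 4 * f y τ + (deriv (fun x => f x τ) y) ^ 2)
    (hconv : 0 ≤ deriv (deriv (fun x => f x τ)) y + 2) :
    deriv (fun t => f y t) τ ≥
      deriv (deriv (fun x => f x τ)) y - (y / 2) * deriv (fun x => f x τ) y + f y τ -
        (deriv (deriv (fun x => f x τ)) y + 2) * (deriv (fun x => f x τ) y) ^ 2 /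
          (8 * ((n : ℝ) - 1) + 4 * f y τ + (deriv (fun x => f x τ) y) ^ 2) := by
  have hy : deriv (fun x => f x τ) = fun x =>
      ε * (2 * x) - K * Real.exp (-τ) * (4 * x ^ 3 - 24 * x) := by
    funext x
    simp only [hf]
    exact (hasDerivAt_hermite_combination ε (K * Real.exp (-τ)) x).deriv
  have hyy : deriv (deriv (fun x => f x τ)) y =
      2 * ε - K * Real.exp (-τ) * (12 * y ^ 2 - 24) := by
    rw [hy]
    exact (hasDerivAt_deriv_hermite_combination ε (K * Real.exp (-τ)) y).deriv
  have hτ : deriv (fun t => f y t) τ =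
      K * Real.exp (-τ) * (y ^ 4 - 12 * y ^ 2 + 12) := by
    simp only [hf]
    have h := (((hasDerivAt_neg τ).exp.const_mul K).mul_const
      (y ^ 4 - 12 * y ^ 2 + 12)).const_sub (ε * (y ^ 2 - 2))
    rw [h.deriv]
    ring
  have linear_part : deriv (fun t => f y t) τ =
      deriv (deriv (fun x => f x τ)) y - (y / 2) * deriv (fun x => f x τ) y + f y τ := by
    rw [hτ, hyy, hy, hf]
    ring
  rw [linear_part]
  exact sub_le_self _ (div_nonneg (mul_nonneg hconv (sq_nonneg _)) hpos.le)
end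

section
/- Let n ≥ 2 be an integer, I ⊆ ℝ an open interval, and u : ℝ × I → ℝ a smooth function with u > 0 everywhere which satisfies the rescaled mean curvature flow profile equation u_τ = u_{yy}/(1+u_y²) − (y/2)·u_y − (n−1)/u + u/2 at every point. Then q := u² − 2(n−1) satisfies 8(n−1) + 4q + q_y² = 4u²(1+u_y²) > 0 and q_τ = q_{yy} − (y/2)·q_y + q − ((q_{yy} + 2)·q_y²)/(8(n−1) + 4q + q_y²) at every point of ℝ × I. -/
/-- if a smooth positive profile `u` on `ℝ × I` solves the rescaled mean
curvature flow profile equation, then `q := u² − 2(n−1)` satisfies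
`8(n−1) + 4q + q_y² = 4u²(1+u_y²) > 0` and the quoted evolution equation on `ℝ × I`. -/
theorem stmt_2 (n : ℕ) (hn : 2 ≤ n) (I : Set ℝ) (hIopen : IsOpen I) (hIconv : Convex ℝ I)
    (u : ℝ → ℝ → ℝ)
    (hu : ContDiffOn ℝ (⊤ : ℕ∞) (Function.uncurry u) ((Set.univ : Set ℝ) ×ˢ I))
    (hupos : ∀ y : ℝ, ∀ τ ∈ I, 0 < u y τ)
    (hPDE : ∀ y : ℝ, ∀ τ ∈ I,
      deriv (fun t => u y t) τ =
        deriv (deriv (fun x => u x τ)) y / (1 + (deriv (fun x => u x τ) y) ^ 2) -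
          (y / 2) * deriv (fun x => u x τ) y - ((n : ℝ) - 1) / u y τ + u y τ / 2)
    (q : ℝ → ℝ → ℝ)
    (hq : ∀ y τ : ℝ, q y τ = (u y τ) ^ 2 - 2 * ((n : ℝ) - 1)) :
    ∀ y : ℝ, ∀ τ ∈ I,
      (8 * ((n : ℝ) - 1) + 4 * q y τ + (deriv (fun x => q x τ) y) ^ 2 =
          4 * (u y τ) ^ 2 * (1 + (deriv (fun x => u x τ) y) ^ 2) ∧
        0 < 8 * ((n : ℝ) - 1) + 4 * q y τ + (deriv (fun x => q x τ) y) ^ 2) ∧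
      deriv (fun t => q y t) τ =
        deriv (deriv (fun x => q x τ)) y - (y / 2) * deriv (fun x => q x τ) y + q y τ -
          (deriv (deriv (fun x => q x τ)) y + 2) * (deriv (fun x => q x τ) y) ^ 2 /
            (8 * ((n : ℝ) - 1) + 4 * q y τ + (deriv (fun x => q x τ) y) ^ 2) := by
  intro y τ hτ
  have hslice : ContDiff ℝ (⊤ : ℕ∞) (fun x => u x τ) := by
    rw [← contDiffOn_univ]
    exact hu.comp (f := fun x : ℝ => (x, τ)) (by fun_prop) (fun x _ => ⟨Set.mem_univ _, hτ⟩)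
  have hdx : Differentiable ℝ (fun x => u x τ) := hslice.differentiable (by simp)
  have hdxx : Differentiable ℝ (deriv (fun x => u x τ)) :=
    ((contDiff_infty_iff_deriv.mp hslice).2).differentiable (by simp)
  have hdt : DifferentiableAt ℝ (fun t => u y t) τ := by
    have hnhds : (Set.univ : Set ℝ) ×ˢ I ∈ nhds (y, τ) :=
      (isOpen_univ.prod hIopen).mem_nhds ⟨Set.mem_univ _, hτ⟩
    have h := (hu.contDiffAt hnhds).differentiableAt (by simp)
    exact h.comp (f := fun t : ℝ => (y, t)) τ (by fun_prop)
  have hqy : deriv (fun x => q x τ) = fun x => 2 * u x τ * deriv (fun x => u x τ) x := by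
    funext x
    simp only [hq]
    simpa using (((hdx x).hasDerivAt.pow 2).sub_const (2 * ((n : ℝ) - 1))).deriv
  have hqyy : deriv (deriv (fun x => q x τ)) y =
      2 * deriv (fun x => u x τ) y * deriv (fun x => u x τ) y +
        2 * u y τ * deriv (deriv (fun x => u x τ)) y := by
    rw [hqy]
    exact (((hdx y).hasDerivAt.const_mul 2).mul (hdxx y).hasDerivAt).deriv
  have hqt : deriv (fun t => q y t) τ = 2 * u y τ * deriv (fun t => u y t) τ := by
    simp only [hq]
    simpa using ((hdt.hasDerivAt.pow 2).sub_const (2 * ((n : ℝ) - 1))).deriv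
  have hu0 : 0 < u y τ := hupos y τ hτ
  rw [hqyy, hqt, hPDE y τ hτ, hqy, hq]
  beta_reduce
  generalize deriv (deriv (fun x => u x τ)) y = r
  generalize deriv (fun x => u x τ) y = p
  generalize u y τ = v at hu0 ⊢
  have hden : 8 * ((n : ℝ) - 1) + 4 * (v ^ 2 - 2 * ((n : ℝ) - 1)) + (2 * v * p) ^ 2 =
      4 * v ^ 2 * (1 + p ^ 2) := by ring
  have hp : 0 < 1 + p ^ 2 := by positivity
  rw [hden]
  refine ⟨⟨rfl, by positivity⟩, ?_⟩
  field_simp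
  ring
end

section
/- Let n ≥ 2 be an integer and ε, K > 0. Set q₀(y,τ) := ε·y² − K·e^{−τ}·y⁴ and 𝒜(y,τ) := (ε²·y² + K²·e^{−2τ}·y⁶)/(2(n−1)), and for y ≠ 0 with 2(n−1) + q₀(y,τ) > 0 define Q(y,τ) := 𝒜(y,τ)·[ ln( e^{τ/2}·(2(n−1) + q₀(y,τ)) ) + (5τ/2) − 8·ln|y| ] + ε + K·e^{−τ}·y². Then at every point (y,τ) with y ≠ 0 and 2(n−1) + q₀(y,τ) > 0 one has ∂_τ Q + (y/2)·∂_y Q − Q = −(ε²·y² + K²·e^{−2τ}·y⁶)/(2(n−1) + q₀(y,τ)) − ε − K·e^{−τ}·y². -/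
/-- with `q₀(y,τ) = ε·y² − K·e^{−τ}·y⁴` and
`𝒜(y,τ) = (ε²y² + K²e^{−2τ}y⁶)/(2(n−1))`, the correction term
`Q(y,τ) = 𝒜·[ln(e^{τ/2}(2(n−1)+q₀)) + 5τ/2 − 8 ln|y|] + ε + K·e^{−τ}·y²`
solves the forced drift transport equation
`∂_τ Q + (y/2)∂_y Q − Q = −(ε²y² + K²e^{−2τ}y⁶)/(2(n−1)+q₀) − ε − K·e^{−τ}·y²`
at every point with `y ≠ 0` and `2(n−1)+q₀ > 0`. -/
theorem stmt_8 (n : ℕ) (hn : 2 ≤ n) (ε K : ℝ) (hε : 0 < ε) (hK : 0 < K)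
    (q₀ A Q : ℝ → ℝ → ℝ)
    (hq₀ : ∀ y τ : ℝ, q₀ y τ = ε * y ^ 2 - K * Real.exp (-τ) * y ^ 4)
    (hA : ∀ y τ : ℝ,
      A y τ = (ε ^ 2 * y ^ 2 + K ^ 2 * Real.exp (-(2 * τ)) * y ^ 6) / (2 * ((n : ℝ) - 1)))
    (hQ : ∀ y τ : ℝ,
      Q y τ = A y τ *
          (Real.log (Real.exp (τ / 2) * (2 * ((n : ℝ) - 1) + q₀ y τ)) + 5 * τ / 2 -
            8 * Real.log |y|) + ε + K * Real.exp (-τ) * y ^ 2) :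
    ∀ y τ : ℝ, y ≠ 0 → 0 < 2 * ((n : ℝ) - 1) + q₀ y τ →
      deriv (fun t => Q y t) τ + (y / 2) * deriv (fun x => Q x τ) y - Q y τ =
        -((ε ^ 2 * y ^ 2 + K ^ 2 * Real.exp (-(2 * τ)) * y ^ 6) /
            (2 * ((n : ℝ) - 1) + q₀ y τ)) - ε - K * Real.exp (-τ) * y ^ 2 := by
  intro y τ hy hpos
  have hn' : (2 : ℝ) ≤ n := by exact_mod_cast hn
  obtain ⟨c, hc⟩ : ∃ c : ℝ, c = 2 * ((n : ℝ) - 1) := ⟨_, rfl⟩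
  have hc0 : c ≠ 0 := by rw [hc]; linarith
  simp only [← hc, hq₀, hA, hQ, Real.log_abs] at hpos ⊢
  have hu := hpos.ne'
  have hexp := (Real.exp_pos (τ / 2)).ne'
  have hv := mul_ne_zero hexp hu
  have he1 : HasDerivAt (fun t : ℝ => Real.exp (-t)) (-Real.exp (-τ)) τ := by
    simpa using (hasDerivAt_id τ).neg.exp
  have he2 : HasDerivAt (fun t : ℝ => Real.exp (-(2 * t))) (-2 * Real.exp (-(2 * τ))) τ := by
    simpa [mul_comm] using ((hasDerivAt_id τ).const_mul 2).neg.exp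
  have he3 : HasDerivAt (fun t : ℝ => Real.exp (t / 2)) (Real.exp (τ / 2) * (1 / 2)) τ := by
    simpa using ((hasDerivAt_id τ).div_const 2).exp
  have hqt := (((he1.const_mul K).mul_const (y ^ 4)).const_sub (ε * y ^ 2)).const_add c
  have hQt := ((((((he2.const_mul (K ^ 2)).mul_const (y ^ 6)).const_add
    (ε ^ 2 * y ^ 2)).div_const c).fun_mul ((((he3.fun_mul hqt).log hv).fun_add
      (((hasDerivAt_id' τ).const_mul 5).div_const 2)).sub_const
        (8 * Real.log y))).add_const ε).fun_add ((he1.const_mul K).mul_const (y ^ 2))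
  have hqy := ((((hasDerivAt_pow 2 y).const_mul ε).fun_sub
    ((hasDerivAt_pow 4 y).const_mul (K * Real.exp (-τ)))).const_add c).const_mul
      (Real.exp (τ / 2))
  have hQy := ((((((hasDerivAt_pow 2 y).const_mul (ε ^ 2)).fun_add
    ((hasDerivAt_pow 6 y).const_mul (K ^ 2 * Real.exp (-(2 * τ))))).div_const c).fun_mul
      (((hqy.log hv).add_const (5 * τ / 2)).fun_sub
        ((Real.hasDerivAt_log hy).const_mul 8))).add_const ε).fun_add
          ((hasDerivAt_pow 2 y).const_mul (K * Real.exp (-τ)))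
  rw [hQt.deriv, hQy.deriv]
  generalize Real.log (Real.exp (τ / 2) * (c + (ε * y ^ 2 - K * Real.exp (-τ) * y ^ 4))) = L
  generalize Real.log y = M
  generalize Real.exp (τ / 2) = E at *
  generalize Real.exp (-(2 * τ)) = F at *
  generalize Real.exp (-τ) = G at *
  obtain ⟨u, hu'⟩ : ∃ u : ℝ, u = c + (ε * y ^ 2 - K * G * y ^ 4) := ⟨_, rfl⟩
  rw [← hu'] at hu ⊢
  push_cast
  field_simp
  rw [hu']
  ring
end

section
/- Let n ≥ 2 be an integer, let m > 2 be a real number, let u ∈ (0, √(2(n−1))), and set Y(v) := (1 − v²/(2(n−1)))^{1/m}. Let A > 0 satisfy A² > (2m/(m−2))·(−Y″(u))/(Y(u)·Y′(u)²). Then (A·Y″(u))/(1 + A²·Y′(u)²) + ((n−1)/u − u/2)·A·Y′(u) + (A/2)·Y(u) > 0; that is, the rescaled superellipsoid profile A·Y is a strict subsolution of the rescaled mean curvature flow operator in flipped coordinates at the point u. -/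
/-- The derivative of the superellipse profile `v ↦ (1 - v² / c) ^ p` inside its domain. -/
theorem hasDerivAt_one_sub_sq_div_rpow {c p u : ℝ} (h : 0 < 1 - u ^ 2 / c) :
    HasDerivAt (fun v : ℝ => (1 - v ^ 2 / c) ^ p)
      (-(2 * u / c) * p * (1 - u ^ 2 / c) ^ (p - 1)) u := by
  have hf : HasDerivAt (fun v : ℝ => 1 - v ^ 2 / c) (-(2 * u / c)) u := by
    simpa using ((hasDerivAt_pow 2 u).div_const c).const_sub 1
  exact hf.rpow_const (Or.inl h.ne')


/-- if `A > 0` satisfies `A² > (2m/(m−2))·(−Y″(u))/(Y(u)·Y′(u)²)` with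
`Y(v) = (1 − v²/(2(n−1)))^{1/m}` and `u ∈ (0, √(2(n−1)))`, `m > 2`, then the rescaled
superellipsoid profile `A·Y` is a strict subsolution of the rescaled mean curvature
flow operator in flipped coordinates at the point `u`:
`(AY″)/(1+A²Y′²) + ((n−1)/u − u/2)·AY′ + (A/2)·Y > 0`. -/
theorem stmt_11 (n : ℕ) (hn : 2 ≤ n) (m : ℝ) (hm : 2 < m)
    (u : ℝ) (hu : u ∈ Set.Ioo (0 : ℝ) (Real.sqrt (2 * ((n : ℝ) - 1))))
    (Y : ℝ → ℝ) (hY : ∀ v : ℝ, Y v = (1 - v ^ 2 / (2 * ((n : ℝ) - 1))) ^ (1 / m))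
    (A : ℝ) (hA : 0 < A)
    (hA2 : (2 * m / (m - 2)) * (-(deriv (deriv Y) u)) / (Y u * (deriv Y u) ^ 2) < A ^ 2) :
    0 < A * deriv (deriv Y) u / (1 + A ^ 2 * (deriv Y u) ^ 2) +
        (((n : ℝ) - 1) / u - u / 2) * (A * deriv Y u) + (A / 2) * Y u := by
  obtain ⟨hu0, hu1⟩ := hu
  have hn' : (2 : ℝ) ≤ n := by exact_mod_cast hn
  obtain ⟨c, hc⟩ : ∃ c : ℝ, c = 2 * ((n : ℝ) - 1) := ⟨_, rfl⟩
  have hn1 : (n : ℝ) - 1 = c / 2 := by linarith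
  have hc0 : 0 < c := by linarith
  rw [← hc] at hu1
  simp only [← hc] at hY
  rw [hn1]
  have hf : 0 < 1 - u ^ 2 / c := by
    rw [sub_pos, div_lt_one hc0]
    exact (Real.lt_sqrt hu0.le).mp hu1
  have hYd : deriv Y u = -(2 * u / c) * (1 / m) * (1 - u ^ 2 / c) ^ (1 / m - 1) := by
    rw [funext hY]
    exact (hasDerivAt_one_sub_sq_div_rpow hf).deriv
  have hYpos : 0 < Y u := by
    rw [hY]
    exact Real.rpow_pos_of_pos hf _
  have hm0 : 0 < m := by linarith
  have hm2 : 0 < m - 2 := by linarith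
  have hYneg : deriv Y u < 0 := by
    have hpow := Real.rpow_pos_of_pos hf (1 / m - 1)
    have : 0 < 2 * u / c * (1 / m) * (1 - u ^ 2 / c) ^ (1 / m - 1) := by positivity
    rw [hYd]
    linarith
  have hode : (c / 2 / u - u / 2) * deriv Y u = -(1 / m) * Y u := by
    have hpow : (1 - u ^ 2 / c) ^ (1 / m) =
        (1 - u ^ 2 / c) ^ (1 / m - 1) * (1 - u ^ 2 / c) := by
      rw [← Real.rpow_add_one hf.ne', sub_add_cancel]
    rw [hYd, hY, hpow]
    generalize (1 - u ^ 2 / c) ^ (1 / m - 1) = P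
    field_simp
  generalize deriv (deriv Y) u = Y₂ at *
  generalize deriv Y u = Y₁ at *
  generalize Y u = Y₀ at *
  have hY₁ : 0 < Y₁ ^ 2 := by nlinarith
  rw [div_lt_iff₀ (by positivity)] at hA2
  have hbound : -Y₂ < (m - 2) / (2 * m) * (A ^ 2 * (Y₀ * Y₁ ^ 2)) := by
    have := mul_lt_mul_of_pos_left hA2 (show 0 < (m - 2) / (2 * m) by positivity)
    rwa [← mul_assoc, show (m - 2) / (2 * m) * (2 * m / (m - 2)) = 1 by field_simp,
      one_mul] at this
  have hD : 0 < 1 + A ^ 2 * Y₁ ^ 2 := by positivity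
  have hrw : A * Y₂ / (1 + A ^ 2 * Y₁ ^ 2) + (c / 2 / u - u / 2) * (A * Y₁) + A / 2 * Y₀ =
      A * (Y₂ + (m - 2) / (2 * m) * Y₀ * (1 + A ^ 2 * Y₁ ^ 2)) / (1 + A ^ 2 * Y₁ ^ 2) := by
    rw [show (c / 2 / u - u / 2) * (A * Y₁) = A * ((c / 2 / u - u / 2) * Y₁) by ring, hode]
    field_simp
    ring
  rw [hrw]
  have hpos : 0 < (m - 2) / (2 * m) * Y₀ := by positivity
  exact div_pos (mul_pos hA (by linarith)) hD
end

section
/- Let n ≥ 2 be an integer and let ℬ : (0,∞) → ℝ be twice differentiable with ℬ″(z)/(1 + ℬ′(z)²) + ((n−1)/z)·ℬ′(z) = 1 and z·ℬ′(z) ≥ ℬ(z) for all z > 0. Let a, A > 0 and b ∈ ℝ, and define y(u) := A + b − (1/(aA))·ℬ(aA·u) for u > 0. Then for every u > 0 one has y″(u)/(1 + y′(u)²) + ((n−1)/u − u/2)·y′(u) + (1/2)·y(u) = (1/2 − a)·A + b/2 + (1/(2aA))·(aAu·ℬ′(aAu) − ℬ(aAu)) ≥ (1/2 − a)·A + b/2.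 -/
/-- let `ℬ` be (the profile of) the unit-speed translating bowl soliton,
i.e. twice differentiable on `(0,∞)` with `ℬ″/(1+ℬ′²) + ((n−1)/z)ℬ′ = 1` and
star-shaped: `z·ℬ′(z) ≥ ℬ(z)`. Then `y(u) := A + b − (1/(aA))·ℬ(aAu)` satisfies, for
every `u > 0`,
`y″/(1+y′²) + ((n−1)/u − u/2)·y′ + y/2
   = (1/2 − a)A + b/2 + (1/(2aA))·(aAu·ℬ′(aAu) − ℬ(aAu)) ≥ (1/2 − a)A + b/2`. -/
theorem stmt_12 (n : ℕ) (hn : 2 ≤ n) (B : ℝ → ℝ)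
    (hB1 : ∀ z : ℝ, 0 < z → DifferentiableAt ℝ B z)
    (hB2 : ∀ z : ℝ, 0 < z → DifferentiableAt ℝ (deriv B) z)
    (hODE : ∀ z : ℝ, 0 < z →
      deriv (deriv B) z / (1 + (deriv B z) ^ 2) + (((n : ℝ) - 1) / z) * deriv B z = 1)
    (hstar : ∀ z : ℝ, 0 < z → B z ≤ z * deriv B z)
    (a A : ℝ) (ha : 0 < a) (hA : 0 < A) (b : ℝ)
    (y : ℝ → ℝ) (hy : ∀ u : ℝ, y u = A + b - (1 / (a * A)) * B (a * A * u)) :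
    ∀ u : ℝ, 0 < u →
      (deriv (deriv y) u / (1 + (deriv y u) ^ 2) +
          (((n : ℝ) - 1) / u - u / 2) * deriv y u + (1 / 2) * y u =
        (1 / 2 - a) * A + b / 2 +
          (1 / (2 * a * A)) * (a * A * u * deriv B (a * A * u) - B (a * A * u))) ∧
      (1 / 2 - a) * A + b / 2 ≤
        deriv (deriv y) u / (1 + (deriv y u) ^ 2) +
          (((n : ℝ) - 1) / u - u / 2) * deriv y u + (1 / 2) * y u := by
  have hc : 0 < a * A := mul_pos ha hA
  have hy' : deriv y = fun u => -deriv B (a * A * u) := by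
    funext u
    rw [funext hy, deriv_const_sub, deriv_const_mul_field, deriv_comp_mul_left, smul_eq_mul]
    field_simp
  have hy'' (u : ℝ) : deriv (deriv y) u = -(a * A * deriv (deriv B) (a * A * u)) := by
    rw [hy', deriv.fun_neg, deriv_comp_mul_left, smul_eq_mul]
  intro u hu
  have hz : 0 < a * A * u := mul_pos hc hu
  have hcurv : deriv (deriv y) u / (1 + (deriv y u) ^ 2) =
      -(a * A) * (1 - ((n : ℝ) - 1) / (a * A * u) * deriv B (a * A * u)) := by
    rw [hy'', hy', neg_sq, ← eq_sub_of_add_eq (hODE _ hz)]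
    ring
  have heq : deriv (deriv y) u / (1 + (deriv y u) ^ 2) +
      (((n : ℝ) - 1) / u - u / 2) * deriv y u + (1 / 2) * y u =
        (1 / 2 - a) * A + b / 2 +
          (1 / (2 * a * A)) * (a * A * u * deriv B (a * A * u) - B (a * A * u)) := by
    rw [hcurv, hy', hy]
    field_simp
    ring
  refine ⟨heq, heq ▸ le_add_of_nonneg_right (mul_nonneg (by positivity) ?_)⟩
  exact sub_nonneg.2 (hstar _ hz)
end

section
/- Let 𝓗 = L²(ℝ, e^{−y²/4}dy), let H₀(y) = 1 and H₂(y) = y² − 2, let π^u be the orthogonal projection of 𝓗 onto the two-dimensional subspace spanned by H₀ and H₂, and let π^s := id − π^u. There exist constants C > 0 and L* ≥ 1 such that for every ℓ₀ ≥ L*, every ε > 0, every (Ω₀, Ω₂) ∈ ℝ² with Ω₀² + Ω₂² = 1, and every measurable χ : ℝ → [0,1] with χ(y) = 1 for |y| ≤ ℓ₀ and χ(y) = 0 for |y| ≥ 2ℓ₀, the function W(y) := ε·χ(y)·(Ω₀·H₀(y) + Ω₂·H₂(y)) belongs to 𝓗 and satisfies ‖π^s W‖ ≤ C·ℓ₀^{3/2}·e^{−ℓ₀²/8}·‖π^u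 W‖; in particular π^u W ≠ 0. -/
open MeasureTheory

/-- The inner product of the Gaussian weighted Hilbert space `𝓗 = L²(ℝ, e^{−y²/4}dy)`. -/
noncomputable def gInner (f g : ℝ → ℝ) : ℝ := ∫ y : ℝ, f y * g y * Real.exp (-y ^ 2 / 4)

/-- The norm of the Gaussian weighted Hilbert space `𝓗 = L²(ℝ, e^{−y²/4}dy)`. -/
noncomputable def gNorm (f : ℝ → ℝ) : ℝ := Real.sqrt (gInner f f)

/-- The Hermite-type polynomial `H₀(y) = 1`. -/
def H0 : ℝ → ℝ := fun _ => 1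

/-- The Hermite-type polynomial `H₂(y) = y² − 2`. -/
def H2 : ℝ → ℝ := fun y => y ^ 2 - 2

/-- The orthogonal projection `π^u` of `𝓗` onto `span{H₀, H₂}` (the two eigenfunctions
`H₀`, `H₂` are orthogonal in `𝓗`). -/
noncomputable def projU (W : ℝ → ℝ) : ℝ → ℝ := fun y =>
  (gInner W H0 / gInner H0 H0) * H0 y + (gInner W H2 / gInner H2 H2) * H2 y

/-- The complementary projection `π^s = id − π^u`. -/
noncomputable def projS (W : ℝ → ℝ) : ℝ → ℝ := fun y => W y - projU W y

section GaussianWeight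

lemma integrable_pow_mul_weight (n : ℕ) :
    Integrable (fun y : ℝ => y ^ n * Real.exp (-y ^ 2 / 4)) := by
  have h := integrable_rpow_mul_exp_neg_mul_sq (b := 1 / 4) (by norm_num) (s := n)
    (lt_of_lt_of_le (by norm_num) (Nat.cast_nonneg n))
  refine h.congr (Filter.Eventually.of_forall fun y => ?_)
  simp only [Real.rpow_natCast]
  congr 2
  ring

lemma tendsto_pow_mul_weight_cocompact (n : ℕ) :
    Filter.Tendsto (fun y : ℝ => y ^ n * Real.exp (-y ^ 2 / 4))
      (Filter.cocompact ℝ) (nhds 0) := by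
  have h := tendsto_rpow_abs_mul_exp_neg_mul_sq_cocompact (a := 1 / 4) (by norm_num) n
  rw [tendsto_zero_iff_norm_tendsto_zero]
  refine h.congr fun y => ?_
  rw [Real.rpow_natCast, norm_mul, norm_pow, Real.norm_eq_abs, Real.norm_eq_abs, Real.abs_exp]
  congr 2
  ring

lemma hasDerivAt_weight (y : ℝ) :
    HasDerivAt (fun y : ℝ => Real.exp (-y ^ 2 / 4)) (-(y / 2) * Real.exp (-y ^ 2 / 4)) y := by
  have h := ((hasDerivAt_pow 2 y).fun_neg.div_const 4).exp
  refine h.congr_deriv ?_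
  push_cast
  ring

/-- Measurable functions of at most quartic growth are integrable against the weight. -/
lemma integrable_mul_weight_of_le {f : ℝ → ℝ} (hf : Measurable f) (K : ℝ)
    (hK : ∀ y, |f y| ≤ K * (1 + y ^ 4)) :
    Integrable (fun y : ℝ => f y * Real.exp (-y ^ 2 / 4)) := by
  have h := ((integrable_pow_mul_weight 0).add (integrable_pow_mul_weight 4)).const_mul K
  refine h.mono' ?_ (Filter.Eventually.of_forall fun y => ?_)
  · exact (hf.mul (by fun_prop)).aestronglyMeasurable
  · rw [norm_mul, Real.norm_eq_abs, Real.norm_eq_abs, Real.abs_exp]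
    simp only [Pi.add_apply]
    calc |f y| * Real.exp (-y ^ 2 / 4) ≤ K * (1 + y ^ 4) * Real.exp (-y ^ 2 / 4) := by
          gcongr; exact hK y
      _ = _ := by ring

lemma gInner_H0_H2 : gInner H0 H2 = 0 := by
  have hd : ∀ y : ℝ, HasDerivAt (fun y : ℝ => -2 * (y ^ 1 * Real.exp (-y ^ 2 / 4)))
      (H0 y * H2 y * Real.exp (-y ^ 2 / 4)) y := fun y => by
    refine (((hasDerivAt_pow 1 y).fun_mul (hasDerivAt_weight y)).const_mul (-2)).congr_deriv ?_
    simp [H0, H2]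
    ring
  have hi : Integrable (fun y : ℝ => H0 y * H2 y * Real.exp (-y ^ 2 / 4)) := by
    refine ((integrable_pow_mul_weight 2).sub
      ((integrable_pow_mul_weight 0).const_mul 2)).congr
      (Filter.Eventually.of_forall fun y => ?_)
    simp [H0, H2]
    ring
  have ht := (tendsto_pow_mul_weight_cocompact 1).const_mul (-2)
  rw [cocompact_eq_atBot_atTop, Filter.tendsto_sup] at ht
  have := integral_of_hasDerivAt_of_tendsto hd hi ht.1 ht.2
  simpa [gInner] using this

/-- Tail bound for the fourth Gaussian moment. -/
lemma setIntegral_Ioi_pow_four_mul_weight_le {l : ℝ} (hl : 4 ≤ l) :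
    ∫ y in Set.Ioi l, y ^ 4 * Real.exp (-y ^ 2 / 4) ≤ 4 * (l ^ 3 * Real.exp (-l ^ 2 / 4)) := by
  have hd : ∀ y ∈ Set.Ici l, HasDerivAt (fun y : ℝ => -4 * (y ^ 3 * Real.exp (-y ^ 2 / 4)))
      (2 * (y ^ 4 * Real.exp (-y ^ 2 / 4)) - 12 * (y ^ 2 * Real.exp (-y ^ 2 / 4))) y :=
    fun y _ => by
      refine (((hasDerivAt_pow 3 y).fun_mul (hasDerivAt_weight y)).const_mul (-4)).congr_deriv ?_
      simp
      ring
  have hi : Integrable (fun y : ℝ =>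
      2 * (y ^ 4 * Real.exp (-y ^ 2 / 4)) - 12 * (y ^ 2 * Real.exp (-y ^ 2 / 4))) :=
    ((integrable_pow_mul_weight 4).const_mul 2).sub ((integrable_pow_mul_weight 2).const_mul 12)
  have ht := (tendsto_pow_mul_weight_cocompact 3).const_mul (-4)
  rw [cocompact_eq_atBot_atTop, Filter.tendsto_sup] at ht
  have h := integral_Ioi_of_hasDerivAt_of_tendsto' hd hi.integrableOn ht.2
  calc _ ≤ ∫ y in Set.Ioi l,
        (2 * (y ^ 4 * Real.exp (-y ^ 2 / 4)) - 12 * (y ^ 2 * Real.exp (-y ^ 2 / 4))) := by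
        refine setIntegral_mono_on (integrable_pow_mul_weight 4).integrableOn hi.integrableOn
          measurableSet_Ioi fun y hy => ?_
        have hy' : 12 ≤ y ^ 2 := by
          have : l < y := hy
          nlinarith
        have h4 : 0 ≤ (y ^ 2 * (y ^ 2 - 12)) * Real.exp (-y ^ 2 / 4) :=
          mul_nonneg (mul_nonneg (sq_nonneg y) (by linarith)) (Real.exp_pos _).le
        nlinarith
    _ = _ := by rw [h]; ring

lemma sq_combination_le {a b : ℝ} (h : a ^ 2 + b ^ 2 = 1) (y : ℝ) :
    (a * H0 y + b * H2 y) ^ 2 ≤ 1 + (y ^ 2 - 2) ^ 2 := by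
  simp only [H0, H2]
  nlinarith [sq_nonneg (a * (y ^ 2 - 2) - b)]

lemma integral_interval_sq_combination {a b : ℝ} (h : a ^ 2 + b ^ 2 = 1) :
    2 ≤ ∫ y in (-2 : ℝ)..2, (a * H0 y + b * H2 y) ^ 2 := by
  have e : ∫ y in (-2 : ℝ)..2, (a * H0 y + b * H2 y) ^ 2
      = 4 * a ^ 2 - 16 / 3 * (a * b) + 112 / 15 * b ^ 2 := by
    have hd : ∀ y ∈ Set.uIcc (-2 : ℝ) 2, HasDerivAt
        (fun y : ℝ => (a - 2 * b) ^ 2 * y + (a - 2 * b) * b * (2 / 3) * y ^ 3 + b ^ 2 / 5 * y ^ 5)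
        ((a * H0 y + b * H2 y) ^ 2) y := fun y _ => by
      refine ((((hasDerivAt_id' y).const_mul ((a - 2 * b) ^ 2)).fun_add
        ((hasDerivAt_pow 3 y).const_mul ((a - 2 * b) * b * (2 / 3)))).fun_add
        ((hasDerivAt_pow 5 y).const_mul (b ^ 2 / 5))).congr_deriv ?_
      simp [H0, H2]
      ring
    rw [intervalIntegral.integral_eq_sub_of_hasDerivAt hd]
    · ring
    · refine Continuous.intervalIntegrable ?_ _ _
      unfold H0 H2
      fun_prop
  rw [e]
  nlinarith [sq_nonneg (a - 4 / 3 * b)]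

/-- Coercivity of truncated linear combinations of `H0` and `H2`. -/
lemma half_le_integral_cutoff {a b : ℝ} (h : a ^ 2 + b ^ 2 = 1) {χ : ℝ → ℝ}
    (hm : Measurable χ) (h01 : ∀ y, χ y ∈ Set.Icc (0 : ℝ) 1) (h1 : ∀ y, |y| ≤ 2 → χ y = 1) :
    1 / 2 ≤ ∫ y, χ y * (a * H0 y + b * H2 y) ^ 2 * Real.exp (-y ^ 2 / 4) := by
  have hi : Integrable
      (fun y => χ y * (a * H0 y + b * H2 y) ^ 2 * Real.exp (-y ^ 2 / 4)) := by
    refine integrable_mul_weight_of_le (hm.mul ?_) 9 fun y => ?_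
    · unfold H0 H2; fun_prop
    · obtain ⟨h0, h1⟩ := h01 y
      rw [abs_of_nonneg (mul_nonneg h0 (sq_nonneg _))]
      nlinarith [sq_combination_le h y, sq_nonneg (a * H0 y + b * H2 y), sq_nonneg (y ^ 2 - 2),
        sq_nonneg (y ^ 2), sq_nonneg y]
  have hexp : (1 / 4 : ℝ) ≤ Real.exp (-1) := by
    rw [Real.exp_neg, one_div]
    exact inv_anti₀ (Real.exp_pos _) (by linarith [Real.exp_one_lt_d9])
  calc (1 / 2 : ℝ) ≤ ∫ y in Set.Ioc (-2 : ℝ) 2, 1 / 4 * (a * H0 y + b * H2 y) ^ 2 := by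
        rw [integral_const_mul, ← intervalIntegral.integral_of_le (by norm_num)]
        linarith [integral_interval_sq_combination h]
    _ ≤ ∫ y in Set.Ioc (-2 : ℝ) 2,
          χ y * (a * H0 y + b * H2 y) ^ 2 * Real.exp (-y ^ 2 / 4) := by
        refine setIntegral_mono_on ?_ hi.integrableOn measurableSet_Ioc fun y hy => ?_
        · refine (Continuous.integrableOn_Icc ?_).mono_set Set.Ioc_subset_Icc_self
          unfold H0 H2; fun_prop
        · rw [h1 y (abs_le.2 ⟨hy.1.le, hy.2⟩), one_mul, mul_comm]
          refine mul_le_mul_of_nonneg_left (hexp.trans (Real.exp_le_exp.2 ?_)) (sq_nonneg _)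
          nlinarith [hy.1, hy.2]
    _ ≤ _ := setIntegral_le_integral hi (Filter.Eventually.of_forall fun y =>
        mul_nonneg (mul_nonneg (h01 y).1 (sq_nonneg _)) (Real.exp_pos _).le)

lemma gInner_H0_self_pos : 0 < gInner H0 H0 := by
  have h := half_le_integral_cutoff (a := 1) (b := 0) (by norm_num) (χ := fun _ => 1)
    measurable_const (by simp) (by simp)
  have e : gInner H0 H0 =
      ∫ y, (1 : ℝ) * (1 * H0 y + 0 * H2 y) ^ 2 * Real.exp (-y ^ 2 / 4) := by
    unfold gInner; congr 1; ext y; ring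
  linarith

lemma gInner_H2_self_pos : 0 < gInner H2 H2 := by
  have h := half_le_integral_cutoff (a := 0) (b := 1) (by norm_num) (χ := fun _ => 1)
    measurable_const (by simp) (by simp)
  have e : gInner H2 H2 =
      ∫ y, (1 : ℝ) * (0 * H0 y + 1 * H2 y) ^ 2 * Real.exp (-y ^ 2 / 4) := by
    unfold gInner; congr 1; ext y; ring
  linarith

section Projection

variable {f : ℝ → ℝ} {K : ℝ}

/-- Expansion of the squared distance to an element of `span {H0, H2}`. -/
lemma gInner_sub_combination (hf : Measurable f) (hK : ∀ y, |f y| ≤ K * (1 + y ^ 2))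
    (a b : ℝ) :
    gInner (fun y => f y - (a * H0 y + b * H2 y)) (fun y => f y - (a * H0 y + b * H2 y)) =
      gInner f f - 2 * a * gInner f H0 - 2 * b * gInner f H2
        + a ^ 2 * gInner H0 H0 + b ^ 2 * gInner H2 H2 := by
  have mH0 : Measurable H0 := measurable_const
  have mH2 : Measurable H2 := by unfold H2; fun_prop
  have b0 : ∀ y, |H0 y| ≤ 1 * (1 + y ^ 2) := fun y => by
    simp only [H0, abs_one]; nlinarith [sq_nonneg y]
  have b2 : ∀ y, |H2 y| ≤ 2 * (1 + y ^ 2) := fun y => by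
    simp only [H2]; exact abs_le.2 ⟨by nlinarith [sq_nonneg y], by nlinarith [sq_nonneg y]⟩
  have key : ∀ {u v : ℝ → ℝ} {c d : ℝ}, Measurable u → Measurable v →
      (∀ y, |u y| ≤ c * (1 + y ^ 2)) → (∀ y, |v y| ≤ d * (1 + y ^ 2)) →
      Integrable (fun y => u y * v y * Real.exp (-y ^ 2 / 4)) := by
    intro u v c d mu mv hu hv
    have hc : 0 ≤ c := by have := (abs_nonneg _).trans (hu 0); simpa using this
    have hd : 0 ≤ d := by have := (abs_nonneg _).trans (hv 0); simpa using this
    refine integrable_mul_weight_of_le (mu.mul mv) (c * d * 2) fun y => ?_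
    rw [abs_mul]
    calc |u y| * |v y| ≤ (c * (1 + y ^ 2)) * (d * (1 + y ^ 2)) :=
          mul_le_mul (hu y) (hv y) (abs_nonneg _) ((abs_nonneg _).trans (hu y))
      _ = c * d * (1 + y ^ 2) ^ 2 := by ring
      _ ≤ c * d * (2 * (1 + y ^ 4)) := by
          gcongr; nlinarith [sq_nonneg (y ^ 2 - 1)]
      _ = _ := by ring
  have ifs := key hf hf hK hK
  have if0 := (key hf mH0 hK b0).const_mul (-(2 * a))
  have if2 := (key hf mH2 hK b2).const_mul (-(2 * b))
  have i00 := (key mH0 mH0 b0 b0).const_mul (a ^ 2)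
  have i22 := (key mH2 mH2 b2 b2).const_mul (b ^ 2)
  have i02 := (key mH0 mH2 b0 b2).const_mul (2 * a * b)
  have e : (fun y => (f y - (a * H0 y + b * H2 y)) * (f y - (a * H0 y + b * H2 y))
        * Real.exp (-y ^ 2 / 4)) = fun y =>
      f y * f y * Real.exp (-y ^ 2 / 4) + -(2 * a) * (f y * H0 y * Real.exp (-y ^ 2 / 4))
        + -(2 * b) * (f y * H2 y * Real.exp (-y ^ 2 / 4))
        + a ^ 2 * (H0 y * H0 y * Real.exp (-y ^ 2 / 4))
        + b ^ 2 * (H2 y * H2 y * Real.exp (-y ^ 2 / 4))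
        + 2 * a * b * (H0 y * H2 y * Real.exp (-y ^ 2 / 4)) := by
    ext y; ring
  have h02 := gInner_H0_H2
  unfold gInner at h02 ⊢
  rw [e, integral_add ((((ifs.fun_add if0).fun_add if2).fun_add i00).fun_add i22) i02,
    integral_add (((ifs.fun_add if0).fun_add if2).fun_add i00) i22,
    integral_add ((ifs.fun_add if0).fun_add if2) i00, integral_add (ifs.fun_add if0) if2,
    integral_add ifs if0]
  simp only [integral_const_mul, h02]
  ring

/-- `projU` is the best approximation from `span {H0, H2}`. -/
lemma gInner_projS_le (hf : Measurable f) (hK : ∀ y, |f y| ≤ K * (1 + y ^ 2)) (a b : ℝ) :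
    gInner (projS f) (projS f) ≤
      gInner (fun y => f y - (a * H0 y + b * H2 y)) (fun y => f y - (a * H0 y + b * H2 y)) := by
  have e := gInner_sub_combination hf hK (gInner f H0 / gInner H0 H0)
    (gInner f H2 / gInner H2 H2)
  have h0 := gInner_H0_self_pos
  have h2 := gInner_H2_self_pos
  change gInner (projS f) (projS f) = _ at e
  rw [e, gInner_sub_combination hf hK, ← sub_nonneg]
  have : 0 ≤ (a - gInner f H0 / gInner H0 H0) ^ 2 * gInner H0 H0
      + (b - gInner f H2 / gInner H2 H2) ^ 2 * gInner H2 H2 := by positivity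
  convert this using 1
  field_simp
  ring

lemma gInner_projU_self (f : ℝ → ℝ) : gInner (projU f) (projU f) =
    gInner f H0 ^ 2 / gInner H0 H0 + gInner f H2 ^ 2 / gInner H2 H2 := by
  have e := gInner_sub_combination (f := fun _ => 0) (K := 0) measurable_const (by simp)
    (gInner f H0 / gInner H0 H0) (gInner f H2 / gInner H2 H2)
  have h0 := gInner_H0_self_pos
  have h2 := gInner_H2_self_pos
  have z : ∀ g, gInner (fun _ => 0) g = 0 := fun g => by simp [gInner]
  have e' : gInner (projU f) (projU f) = gInner
      (fun y => 0 - (gInner f H0 / gInner H0 H0 * H0 y + gInner f H2 / gInner H2 H2 * H2 y))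
      (fun y => 0 - (gInner f H0 / gInner H0 H0 * H0 y + gInner f H2 / gInner H2 H2 * H2 y)) := by
    rw [gInner, gInner]; congr 1; ext y; simp only [projU]; ring
  rw [e', e, z, z, z]
  field_simp
  ring

end Projection

/-- The part of a normalized combination of `H0`, `H2` removed by a cutoff at scale `l` is
Gaussian-small. -/
lemma integral_one_sub_cutoff_le {a b l : ℝ} (h : a ^ 2 + b ^ 2 = 1) (hl : 4 ≤ l) {χ : ℝ → ℝ}
    (h01 : ∀ y, χ y ∈ Set.Icc (0 : ℝ) 1) (h1 : ∀ y, |y| ≤ l → χ y = 1) :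
    ∫ y, (1 - χ y) ^ 2 * (a * H0 y + b * H2 y) ^ 2 * Real.exp (-y ^ 2 / 4) ≤
      8 * (l ^ 3 * Real.exp (-l ^ 2 / 4)) := by
  set g : ℝ → ℝ := (Set.Ioi l).indicator fun y => y ^ 4 * Real.exp (-y ^ 2 / 4) with hg
  have pt : ∀ y, (1 - χ y) ^ 2 * (a * H0 y + b * H2 y) ^ 2 * Real.exp (-y ^ 2 / 4) ≤ g |y| := by
    intro y
    by_cases hy : |y| ≤ l
    · have : |y| ∉ Set.Ioi l := not_lt.2 hy
      rw [hg, Set.indicator_of_notMem this, h1 y hy]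
      simp
    · have hy' : |y| ∈ Set.Ioi l := not_le.1 hy
      have hy2 : 16 ≤ y ^ 2 := by
        have : l < |y| := hy'
        rw [← sq_abs]; nlinarith
      rw [hg, Set.indicator_of_mem hy', sq_abs, show |y| ^ 4 = y ^ 4 from Even.pow_abs (by decide) y]
      have hc : (1 - χ y) ^ 2 ≤ 1 := by
        obtain ⟨h0, h1⟩ := h01 y
        nlinarith
      refine mul_le_mul_of_nonneg_right ?_ (Real.exp_pos _).le
      calc (1 - χ y) ^ 2 * (a * H0 y + b * H2 y) ^ 2 ≤ 1 * (1 + (y ^ 2 - 2) ^ 2) :=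
            mul_le_mul hc (sq_combination_le h y) (sq_nonneg _) zero_le_one
        _ ≤ y ^ 4 := by nlinarith
  have hgi : Integrable fun y => g |y| := by
    refine ((integrable_pow_mul_weight 4).indicator
      (measurableSet_lt measurable_const measurable_id.abs : MeasurableSet {y : ℝ | l < |y|})).congr
      (Filter.Eventually.of_forall fun y => ?_)
    simp [hg, Set.indicator, Even.pow_abs (show Even 4 by decide) y]
  calc _ ≤ ∫ y, g |y| := by
        refine integral_mono_of_nonneg (Filter.Eventually.of_forall fun y => ?_) hgi
          (Filter.Eventually.of_forall pt)
        exact mul_nonneg (mul_nonneg (sq_nonneg _) (sq_nonneg _)) (Real.exp_pos _).le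
    _ = 2 * ∫ y in Set.Ioi l, y ^ 4 * Real.exp (-y ^ 2 / 4) := by
        rw [integral_comp_abs, hg, setIntegral_indicator measurableSet_Ioi,
          Set.inter_eq_right.2 (Set.Ioi_subset_Ioi (by linarith))]
    _ ≤ _ := by linarith [setIntegral_Ioi_pow_four_mul_weight_le hl]

end GaussianWeight

/-- the truncated perturbation
`W(y) = ε·χ(y)·(Ω₀H₀(y) + Ω₂H₂(y))` almost lies in the unstable subspace:
`‖π^s W‖ ≤ C·ℓ₀^{3/2}·e^{−ℓ₀²/8}·‖π^u W‖`, and in particular `π^u W ≠ 0`. -/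
theorem stmt_13 :
    ∃ C > (0 : ℝ), ∃ Lstar : ℝ, 1 ≤ Lstar ∧
      ∀ ℓ₀ : ℝ, Lstar ≤ ℓ₀ →
      ∀ ε : ℝ, 0 < ε →
      ∀ Ω₀ Ω₂ : ℝ, Ω₀ ^ 2 + Ω₂ ^ 2 = 1 →
      ∀ χ : ℝ → ℝ, Measurable χ → (∀ y : ℝ, χ y ∈ Set.Icc (0 : ℝ) 1) →
        (∀ y : ℝ, |y| ≤ ℓ₀ → χ y = 1) → (∀ y : ℝ, 2 * ℓ₀ ≤ |y| → χ y = 0) →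
      ∀ W : ℝ → ℝ, (∀ y : ℝ, W y = ε * χ y * (Ω₀ * H0 y + Ω₂ * H2 y)) →
        Integrable (fun y : ℝ => (W y) ^ 2 * Real.exp (-y ^ 2 / 4)) ∧
        gNorm (projS W) ≤ C * ℓ₀ ^ ((3 : ℝ) / 2) * Real.exp (-ℓ₀ ^ 2 / 8) * gNorm (projU W) ∧
        projU W ≠ 0 := by
  have h0 := gInner_H0_self_pos
  have h2 := gInner_H2_self_pos
  set N := gInner H0 H0 + gInner H2 H2 with hN
  have hNpos : 0 < N := by positivity
  refine ⟨Real.sqrt (32 * N), by positivity, 4, by norm_num, ?_⟩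
  intro l hl ε hε a b hab χ hm h01 h1 _ W hW
  have hWm : Measurable W := by
    rw [funext hW]; unfold H0 H2; fun_prop
  have hWsq : ∀ y, W y ^ 2 ≤ ε ^ 2 * (1 + (y ^ 2 - 2) ^ 2) := fun y => by
    obtain ⟨hx0, hx1⟩ := h01 y
    rw [hW, mul_pow, mul_pow, mul_assoc]
    have : χ y ^ 2 ≤ 1 := by nlinarith
    have := mul_le_mul this (sq_combination_le hab y) (sq_nonneg _) zero_le_one
    rw [one_mul] at this
    gcongr
  have hWb : ∀ y, |W y| ≤ (3 * ε) * (1 + y ^ 2) := fun y => by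
    refine abs_le_of_sq_le_sq ((hWsq y).trans ?_) (by positivity)
    rw [mul_assoc, mul_pow, mul_pow, mul_left_comm]
    gcongr
    nlinarith [sq_nonneg (y ^ 2), sq_nonneg y]
  have hS : gInner (projS W) (projS W) ≤ ε ^ 2 * (8 * (l ^ 3 * Real.exp (-l ^ 2 / 4))) := by
    refine (gInner_projS_le hWm hWb (ε * a) (ε * b)).trans ?_
    refine le_trans (le_of_eq ?_)
      (mul_le_mul_of_nonneg_left (integral_one_sub_cutoff_le hab hl h01 h1) (sq_nonneg ε))
    rw [← integral_const_mul]
    unfold gInner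
    congr 1
    ext y
    simp only [hW]
    ring
  have hU : ε ^ 2 / (4 * N) ≤ gInner (projU W) (projU W) := by
    have hA : ε / 2 ≤ a * gInner W H0 + b * gInner W H2 := by
      have hint : ∀ {v : ℝ → ℝ}, Measurable v → (∀ y, |v y| ≤ 2 * (1 + y ^ 2)) →
          Integrable (fun y => W y * v y * Real.exp (-y ^ 2 / 4)) := by
        intro v mv hv
        refine integrable_mul_weight_of_le (hWm.mul mv) (12 * ε) fun y => ?_
        rw [abs_mul]
        calc |W y| * |v y| ≤ ((3 * ε) * (1 + y ^ 2)) * (2 * (1 + y ^ 2)) :=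
              mul_le_mul (hWb y) (hv y) (abs_nonneg _) (by positivity)
          _ = 6 * ε * (1 + y ^ 2) ^ 2 := by ring
          _ ≤ 6 * ε * (2 * (1 + y ^ 4)) := by
              gcongr; nlinarith [sq_nonneg (y ^ 2 - 1)]
          _ = _ := by ring
      have key : a * gInner W H0 + b * gInner W H2 =
          ε * ∫ y, χ y * (a * H0 y + b * H2 y) ^ 2 * Real.exp (-y ^ 2 / 4) := by
        unfold gInner
        rw [← integral_const_mul, ← integral_const_mul, ← integral_const_mul, ← integral_add]
        · congr 1
          ext y
          rw [hW]
          ring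
        · refine (hint measurable_const fun y => ?_).const_mul a
          change |(1 : ℝ)| ≤ _
          rw [abs_one]; nlinarith [sq_nonneg y]
        · refine (hint (by unfold H2; fun_prop) fun y => ?_).const_mul b
          simp only [H2]
          exact abs_le.2 ⟨by nlinarith [sq_nonneg y], by nlinarith [sq_nonneg y]⟩
      have := half_le_integral_cutoff hab hm h01 fun y hy => h1 y (by linarith)
      rw [key]
      nlinarith
    have hAB : ε ^ 2 / 4 ≤ gInner W H0 ^ 2 + gInner W H2 ^ 2 := by
      nlinarith [sq_nonneg (a * gInner W H2 - b * gInner W H0)]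
    rw [gInner_projU_self]
    calc ε ^ 2 / (4 * N) = (ε ^ 2 / 4) / N := by rw [div_div]
      _ ≤ (gInner W H0 ^ 2 + gInner W H2 ^ 2) / N := by gcongr
      _ = gInner W H0 ^ 2 / N + gInner W H2 ^ 2 / N := add_div _ _ _
      _ ≤ _ := by gcongr <;> linarith
  refine ⟨?_, ?_, ?_⟩
  · refine integrable_mul_weight_of_le (hWm.pow_const 2) (9 * ε ^ 2) fun y => ?_
    rw [abs_of_nonneg (sq_nonneg _)]
    refine (hWsq y).trans ?_
    rw [mul_comm 9, mul_assoc]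
    gcongr
    nlinarith [sq_nonneg (y ^ 2), sq_nonneg y]
  · have hl0 : 0 < l := by linarith
    refine Real.sqrt_le_iff.2 ⟨by unfold gNorm; positivity, hS.trans ?_⟩
    have e1 : (l ^ ((3 : ℝ) / 2)) ^ 2 = l ^ 3 := by
      rw [← Real.rpow_natCast, ← Real.rpow_mul hl0.le, ← Real.rpow_natCast]
      norm_num
    have e2 : Real.exp (-l ^ 2 / 8) ^ 2 = Real.exp (-l ^ 2 / 4) := by
      rw [← Real.exp_nat_mul]
      congr 1
      push_cast
      ring
    have hUnn : 0 ≤ gInner (projU W) (projU W) := le_trans (by positivity) hU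
    rw [mul_pow, mul_pow, mul_pow, e1, e2, gNorm, Real.sq_sqrt hUnn, Real.sq_sqrt (by positivity)]
    calc ε ^ 2 * (8 * (l ^ 3 * Real.exp (-l ^ 2 / 4)))
        = 32 * N * l ^ 3 * Real.exp (-l ^ 2 / 4) * (ε ^ 2 / (4 * N)) := by field_simp; ring
      _ ≤ _ := by gcongr
  · intro hz
    have : gInner (projU W) (projU W) = 0 := by rw [hz]; simp [gInner]
    have : 0 < ε ^ 2 / (4 * N) := by positivity
    linarith
end
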